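/- Strict suboptimality of standard mechanisms (the lower bound is not attained): For any N ≥ 1, any nonnegative payment mechanism R : X^N → ℝ^N, any individual i, any ε > 0, and any Nash equilibrium σ of R in which individual i's strategy is the ε-strategy, the expected payment to individual i at σ is strictly greater than V_LB(ε) = g'(ε)·((e^ε+1)/e^ε)·((θ/(2θ−1))·(e^ε+1) − 1). (In particular, if E_σ[R_i(X) | X_i = 1, W = 0] = 0 and E_σ[R_i(X) | X_i = 0, W = 1] = 0, then R_i vanishes on {0,1}^N.) -/

import Mathlib

open Real

/-- The set of possible reports: `some b` is report `b ∈ {0,1}`, `none` is nonparticipation `⊥`. -/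
abbrev Report := Option Bool

/-- A (behavioral) strategy: a conditional distribution of the report given the signal. -/
def IsStrategy (σ : Bool → Report → ℝ) : Prop :=
  (∀ s x, 0 ≤ σ s x) ∧ ∀ s, ∑ x : Report, σ s x = 1

/-- `P_σ(X ∈ E | S = s)`. -/
def probE (σ : Bool → Report → ℝ) (E : Finset Report) (s : Bool) : ℝ :=
  ∑ x ∈ E, σ s x

/-- One log-likelihood-ratio term `ln(a/b)`, with the convention `0/0 = 1`,
clamped into `[0,∞]` (this does not change the supremum defining the privacy level,
since the supremum is always ≥ 0). -/
noncomputable def llr (a b : ℝ) : ENNReal :=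
  if a = 0 ∧ b = 0 then 0
  else if b = 0 then ⊤
  else ENNReal.ofReal (Real.log (a / b))

/-- The (local) differential privacy level `ζ(σ)` of a strategy, valued in `[0,∞]`. -/
noncomputable def privLevel (σ : Bool → Report → ℝ) : ENNReal :=
  ⨆ (E : Finset Report), ⨆ (s : Bool), llr (probE σ E s) (probE σ E (!s))

/-- The privacy cost `g(ζ(σ))`, valued in extended reals (at `ζ = ∞` we take the
supremum extension of `g`). -/
noncomputable def privCost (g : ℝ → ℝ) (σ : Bool → Report → ℝ) : EReal :=
  if privLevel σ = ⊤ then ⨆ x ∈ Set.Ici (0:ℝ), ((g x : ℝ) : EReal)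
  else ((g (privLevel σ).toReal : ℝ) : EReal)

/-- `P(S_i = s | W = w) = θ` if `s = w`, else `1 - θ`. -/
def signalProb (θ : ℝ) (w s : Bool) : ℝ := if s = w then θ else 1 - θ

/-- Joint probability of state `w`, signals `s` and reports `x`, where `p = P_W(1)`. -/
def jointProb {N : ℕ} (p θ : ℝ) (σ : Fin N → Bool → Report → ℝ)
    (w : Bool) (s : Fin N → Bool) (x : Fin N → Report) : ℝ :=
  (if w then p else 1 - p) * ∏ i, (signalProb θ w (s i) * σ i (s i) (x i))

/-- Expected payment `E_σ[R_i(X)]` to individual `i`. -/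
noncomputable def expPay {N : ℕ} (p θ : ℝ) (σ : Fin N → Bool → Report → ℝ)
    (R : (Fin N → Report) → Fin N → ℝ) (i : Fin N) : ℝ :=
  ∑ w : Bool, ∑ s : Fin N → Bool, ∑ x : Fin N → Report,
    jointProb p θ σ w s x * R x i

/-- Expected utility of individual `i`: expected payment minus privacy cost. -/
noncomputable def utility {N : ℕ} (p θ : ℝ) (g : ℝ → ℝ)
    (σ : Fin N → Bool → Report → ℝ)
    (R : (Fin N → Report) → Fin N → ℝ) (i : Fin N) : EReal :=
  ((expPay p θ σ R i : ℝ) : EReal) - privCost g (σ i)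

/-- `σ` is a Nash equilibrium of the payment mechanism `R`. -/
def NashEq {N : ℕ} (p θ : ℝ) (g : ℝ → ℝ)
    (σ : Fin N → Bool → Report → ℝ)
    (R : (Fin N → Report) → Fin N → ℝ) : Prop :=
  (∀ i, IsStrategy (σ i)) ∧
  ∀ (i : Fin N) (σ' : Bool → Report → ℝ), IsStrategy σ' →
    utility p θ g (Function.update σ i σ') R i ≤ utility p θ g σ R i

/-- The `ε`-strategy: symmetric randomized response flipping with prob. `1/(e^ε+1)`. -/
noncomputable def epsStrategy (ε : ℝ) : Bool → Report → ℝ :=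
  fun s x => match x with
  | none => 0
  | some b => if b = s then Real.exp ε / (Real.exp ε + 1) else 1 / (Real.exp ε + 1)

/-- The lower bound `V_LB(ε)` on the value of `ε` units of privacy. -/
noncomputable def VLB (θ : ℝ) (g' : ℝ → ℝ) (ε : ℝ) : ℝ :=
  g' ε * ((Real.exp ε + 1) / Real.exp ε) *
    ((θ / (2 * θ - 1)) * (Real.exp ε + 1) - 1)

/-- The hypotheses on the privacy cost function `g` (with derivative `g'`):
proper (nonnegative, `g(0) = 0`, non-decreasing), convex, continuously differentiable,
and vanishing only at `0`. -/
structure ProperCost (g g' : ℝ → ℝ) : Prop where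
  conv : ConvexOn ℝ (Set.Ici 0) g
  deriv : ∀ x ∈ Set.Ici (0:ℝ), HasDerivAt g (g' x) x
  derivCont : ContinuousOn g' (Set.Ici 0)
  mono : MonotoneOn g (Set.Ici 0)
  nonneg : ∀ x ∈ Set.Ici (0:ℝ), 0 ≤ g x
  zero : g 0 = 0
  pos : ∀ x > (0:ℝ), 0 < g x


/-- The conditional expected payment `E_σ[R_i(X) | X_i = b, W = w]`. -/
noncomputable def condPay {N : ℕ} (p θ : ℝ) (σ : Fin N → Bool → Report → ℝ)
    (R : (Fin N → Report) → Fin N → ℝ) (i : Fin N) (b w : Bool) : ℝ :=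
  (∑ s : Fin N → Bool, ∑ x ∈ Finset.univ.filter (fun x : Fin N → Report => x i = some b),
      jointProb p θ σ w s x * R x i) /
    (∑ s : Fin N → Bool, ∑ x ∈ Finset.univ.filter (fun x : Fin N → Report => x i = some b),
      jointProb p θ σ w s x)

section Helpers

open Finset

/-- `P_σ(X = x | W = w)` for an individual with strategy `τ`. -/
noncomputable def reportProb (θ : ℝ) (τ : Bool → Report → ℝ) (w : Bool) (x : Report) : ℝ :=
  ∑ s : Bool, signalProb θ w s * τ s x

/-- `P_W(w)` times the expected payment to `i` given `X_i = b` and `W = w`, which depends only on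
the strategies of the others. -/
noncomputable def payWeight {N : ℕ} (p θ : ℝ) (σ : Fin N → Bool → Report → ℝ)
    (R : (Fin N → Report) → Fin N → ℝ) (i : Fin N) (w : Bool) (b : Report) : ℝ :=
  ∑ x ∈ univ.filter (fun x : Fin N → Report => x i = b),
    (if w then p else 1 - p) * (∏ j ∈ univ.erase i, reportProb θ (σ j) w (x j)) * R x i

lemma signalProb_pos {θ : ℝ} (hθ0 : 0 < θ) (hθ1 : θ < 1) (w s : Bool) :
    0 < signalProb θ w s := by
  unfold signalProb
  split_ifs <;> linarith

lemma reportProb_nonneg {θ : ℝ} (hθ0 : 0 < θ) (hθ1 : θ < 1) {τ : Bool → Report → ℝ}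
    (hτ : IsStrategy τ) (w : Bool) (x : Report) : 0 ≤ reportProb θ τ w x :=
  sum_nonneg fun s _ => mul_nonneg (signalProb_pos hθ0 hθ1 w s).le (hτ.1 s x)

lemma reportProb_eq_zero_iff {θ : ℝ} (hθ0 : 0 < θ) (hθ1 : θ < 1) {τ : Bool → Report → ℝ}
    (hτ : IsStrategy τ) (w : Bool) (x : Report) :
    reportProb θ τ w x = 0 ↔ ∀ s, τ s x = 0 := by
  unfold reportProb
  rw [sum_eq_zero_iff_of_nonneg
    fun s _ => mul_nonneg (signalProb_pos hθ0 hθ1 w s).le (hτ.1 s x)]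
  simp [(signalProb_pos hθ0 hθ1 w _).ne']

lemma state_prob_pos {p : ℝ} (hp0 : 0 < p) (hp1 : p < 1) (w : Bool) :
    0 < (if w then p else 1 - p) := by
  split_ifs <;> linarith

section PayWeight

variable {N : ℕ} {p θ : ℝ} {σ : Fin N → Bool → Report → ℝ}
  {R : (Fin N → Report) → Fin N → ℝ}

lemma payWeight_term_nonneg (hp0 : 0 < p) (hp1 : p < 1) (hθ0 : 0 < θ) (hθ1 : θ < 1)
    (hσ : ∀ j, IsStrategy (σ j)) (hR : ∀ x i, 0 ≤ R x i) (i : Fin N) (w : Bool)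
    (x : Fin N → Report) :
    0 ≤ (if w then p else 1 - p) * (∏ j ∈ univ.erase i, reportProb θ (σ j) w (x j)) * R x i :=
  mul_nonneg (mul_nonneg (state_prob_pos hp0 hp1 w).le
    (prod_nonneg fun j _ => reportProb_nonneg hθ0 hθ1 (hσ j) w (x j))) (hR x i)

lemma payWeight_nonneg (hp0 : 0 < p) (hp1 : p < 1) (hθ0 : 0 < θ) (hθ1 : θ < 1)
    (hσ : ∀ j, IsStrategy (σ j)) (hR : ∀ x i, 0 ≤ R x i) (i : Fin N) (w : Bool) (b : Report) :
    0 ≤ payWeight p θ σ R i w b :=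
  sum_nonneg fun x _ => payWeight_term_nonneg hp0 hp1 hθ0 hθ1 hσ hR i w x

lemma payWeight_eq_zero_of_eq_zero (hp0 : 0 < p) (hp1 : p < 1) (hθ0 : 0 < θ) (hθ1 : θ < 1)
    (hσ : ∀ j, IsStrategy (σ j)) (hR : ∀ x i, 0 ≤ R x i) {i : Fin N} {w : Bool} {b : Report}
    (h : payWeight p θ σ R i w b = 0) (w' : Bool) : payWeight p θ σ R i w' b = 0 := by
  unfold payWeight at h ⊢
  rw [sum_eq_zero_iff_of_nonneg
    fun x _ => payWeight_term_nonneg hp0 hp1 hθ0 hθ1 hσ hR i _ x] at h ⊢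
  intro x hx
  have := h x hx
  simp only [mul_eq_zero, (state_prob_pos hp0 hp1 _).ne', false_or, prod_eq_zero_iff,
    reportProb_eq_zero_iff hθ0 hθ1 (hσ _)] at this ⊢
  exact this

lemma sum_jointProb (w : Bool) (x : Fin N → Report) (i : Fin N) :
    ∑ s : Fin N → Bool, jointProb p θ σ w s x =
      reportProb θ (σ i) w (x i) *
        ((if w then p else 1 - p) * ∏ j ∈ univ.erase i, reportProb θ (σ j) w (x j)) := by
  have h : ∏ j, reportProb θ (σ j) w (x j) =
      ∑ s : Fin N → Bool, ∏ j, (signalProb θ w (s j) * σ j (s j) (x j)) := by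
    simp only [reportProb, prod_univ_sum, Fintype.piFinset_univ]
  simp only [jointProb]
  rw [← mul_sum, ← h, ← mul_prod_erase univ _ (mem_univ i)]
  ring

lemma sum_jointProb_mul_pay (w : Bool) (b : Report) (i : Fin N) :
    ∑ s : Fin N → Bool, ∑ x ∈ univ.filter (fun x : Fin N → Report => x i = b),
      jointProb p θ σ w s x * R x i = reportProb θ (σ i) w b * payWeight p θ σ R i w b := by
  rw [sum_comm, payWeight, mul_sum]
  refine sum_congr rfl fun x hx => ?_
  rw [← sum_mul, sum_jointProb w x i, (mem_filter.1 hx).2]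
  ring

lemma payWeight_update (τ : Bool → Report → ℝ) (i : Fin N) (w : Bool) (b : Report) :
    payWeight p θ (Function.update σ i τ) R i w b = payWeight p θ σ R i w b := by
  unfold payWeight
  refine sum_congr rfl fun x _ => ?_
  congr 2
  refine prod_congr rfl fun j hj => ?_
  rw [Function.update_of_ne (ne_of_mem_erase hj)]

lemma expPay_update (τ : Bool → Report → ℝ) (i : Fin N) :
    expPay p θ (Function.update σ i τ) R i =
      ∑ w : Bool, ∑ b : Report, reportProb θ τ w b * payWeight p θ σ R i w b := by
  unfold expPay
  refine sum_congr rfl fun w _ => ?_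
  have h (b : Report) := sum_jointProb_mul_pay (p := p) (θ := θ)
    (σ := Function.update σ i τ) (R := R) w b i
  simp only [payWeight_update, Function.update_self] at h
  simp only [← h]
  rw [sum_comm (s := (univ : Finset Report))]
  refine sum_congr rfl fun s _ => ?_
  exact (sum_fiberwise univ (fun x : Fin N → Report => x i) _).symm

lemma expPay_update_epsStrategy (i : Fin N) (δ : ℝ) :
    expPay p θ (Function.update σ i (epsStrategy δ)) R i =
      (1 - (exp δ + 1)⁻¹) * ((2 * θ - 1) *
        (payWeight p θ σ R i true (some true) + payWeight p θ σ R i false (some false)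
          - (payWeight p θ σ R i true (some false) + payWeight p θ σ R i false (some true))))
      + ((1 - θ) * (payWeight p θ σ R i true (some true) + payWeight p θ σ R i false (some false))
        + θ * (payWeight p θ σ R i true (some false) + payWeight p θ σ R i false (some true))) := by
  have h : exp δ / (exp δ + 1) = 1 - (exp δ + 1)⁻¹ := by
    have := exp_pos δ
    field_simp
    ring
  rw [expPay_update]
  simp only [Fintype.sum_bool, Fintype.sum_option, reportProb, signalProb, epsStrategy, h]
  simp
  ring

lemma jointProb_nonneg (hp0 : 0 < p) (hp1 : p < 1) (hθ0 : 0 < θ) (hθ1 : θ < 1)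
    (hσ : ∀ j, IsStrategy (σ j)) (w : Bool) (s : Fin N → Bool) (x : Fin N → Report) :
    0 ≤ jointProb p θ σ w s x :=
  mul_nonneg (state_prob_pos hp0 hp1 w).le <| prod_nonneg fun j _ =>
    mul_nonneg (signalProb_pos hθ0 hθ1 w (s j)).le ((hσ j).1 _ _)

lemma payWeight_eq_zero_of_condPay_eq_zero (hp0 : 0 < p) (hp1 : p < 1) (hθ0 : 0 < θ)
    (hθ1 : θ < 1) (hσ : ∀ j, IsStrategy (σ j)) {i : Fin N} {b w : Bool}
    (hpos : ∀ s, σ i s (some b) ≠ 0) (h : condPay p θ σ R i b w = 0) :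
    payWeight p θ σ R i w (some b) = 0 := by
  have hnum : ∑ s : Fin N → Bool, ∑ x ∈ univ.filter (fun x : Fin N → Report => x i = some b),
      jointProb p θ σ w s x * R x i = 0 := by
    rcases div_eq_zero_iff.1 h with h | h
    · exact h
    · have hJ := jointProb_nonneg hp0 hp1 hθ0 hθ1 hσ w
      rw [sum_eq_zero_iff_of_nonneg fun s _ => sum_nonneg fun x _ => hJ s x] at h
      refine sum_eq_zero fun s hs => sum_eq_zero fun x hx => ?_
      rw [(sum_eq_zero_iff_of_nonneg fun x _ => hJ s x).1 (h s hs) x hx, zero_mul]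
  rw [sum_jointProb_mul_pay] at hnum
  refine (mul_eq_zero.1 hnum).resolve_left fun h0 => ?_
  exact hpos true ((reportProb_eq_zero_iff hθ0 hθ1 (hσ i) w (some b)).1 h0 true)

end PayWeight

lemma epsStrategy_isStrategy (δ : ℝ) : IsStrategy (epsStrategy δ) := by
  have := exp_pos δ
  refine ⟨fun s x => ?_, fun s => ?_⟩
  · rcases x with _ | b
    · simp [epsStrategy]
    · simp only [epsStrategy]
      split_ifs <;> positivity
  · cases s <;> simp [epsStrategy, Fintype.sum_option] <;> field_simp
    ring

lemma epsStrategy_le_exp_mul {δ : ℝ} (hδ : 0 < δ) (s s' : Bool) (x : Report) :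
    epsStrategy δ s x ≤ exp δ * epsStrategy δ s' x := by
  have h1 : 1 < exp δ := one_lt_exp_iff.2 hδ
  have hp : 0 < exp δ + 1 := by linarith
  rcases x with _ | b
  · simp [epsStrategy]
  · simp only [epsStrategy]
    split_ifs <;> rw [← mul_div_assoc] <;> gcongr <;> nlinarith

lemma privLevel_epsStrategy {δ : ℝ} (hδ : 0 < δ) :
    privLevel (epsStrategy δ) = ENNReal.ofReal δ := by
  apply le_antisymm
  · refine iSup_le fun E => iSup_le fun s => ?_
    have hnn (s) : 0 ≤ probE (epsStrategy δ) E s :=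
      sum_nonneg fun x _ => (epsStrategy_isStrategy δ).1 s x
    have hle : probE (epsStrategy δ) E s ≤ exp δ * probE (epsStrategy δ) E (!s) := by
      unfold probE
      rw [mul_sum]
      exact sum_le_sum fun x _ => epsStrategy_le_exp_mul hδ _ _ x
    unfold llr
    split_ifs with h h'
    · exact zero_le
    · rw [h', mul_zero] at hle
      exact absurd ⟨le_antisymm hle (hnn s), h'⟩ h
    · apply ENNReal.ofReal_le_ofReal
      have hb : 0 < probE (epsStrategy δ) E (!s) := lt_of_le_of_ne (hnn _) (Ne.symm h')
      rcases (hnn s).eq_or_lt with ha | ha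
      · simpa [← ha] using hδ.le
      · rw [Real.log_le_iff_le_exp (by positivity), div_le_iff₀ hb]
        exact hle
  · refine le_iSup_of_le {some true} (le_iSup_of_le true (le_of_eq ?_))
    have := exp_pos δ
    have hp : exp δ + 1 ≠ 0 := by positivity
    simp [llr, probE, epsStrategy, hp]

lemma privCost_epsStrategy (g : ℝ → ℝ) {δ : ℝ} (hδ : 0 < δ) :
    privCost g (epsStrategy δ) = ((g δ : ℝ) : EReal) := by
  simp [privCost, privLevel_epsStrategy hδ, hδ.le]

lemma ProperCost.deriv_pos {g g' : ℝ → ℝ} (hg : ProperCost g g') {ε : ℝ} (hε : 0 < ε) :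
    0 < g' ε := by
  have h := hg.conv.slope_le_of_hasDerivAt (Set.mem_Ici.2 le_rfl) (Set.mem_Ici.2 hε.le) hε
    (hg.deriv ε hε.le)
  rw [slope_def_field, hg.zero, sub_zero, sub_zero] at h
  exact (div_pos (hg.pos ε hε) hε).trans_le h

lemma deriv_eq_of_isLocalMax {g : ℝ → ℝ} {D C ε d : ℝ}
    (hd : HasDerivAt g d ε)
    (hmax : IsLocalMax (fun δ => (1 - (exp δ + 1)⁻¹) * D + C - g δ) ε) :
    D * exp ε = d * (exp ε + 1) ^ 2 := by
  have hp : exp ε + 1 ≠ 0 := by positivity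
  have h := hmax.hasDerivAt_eq_zero
    ((((((hasDerivAt_exp ε).add_const 1).inv hp).const_sub 1).mul_const D).add_const C |>.sub hd)
  field_simp at h
  linarith

end Helpers

/-- **Strict suboptimality of standard mechanisms:** for any nonnegative payment
mechanism `R` and any Nash equilibrium `σ` of `R` in which individual `i` uses the
`ε`-strategy (`ε > 0`), the expected payment to `i` is strictly greater than `V_LB(ε)`.
In particular, if `E_σ[R_i(X)|X_i=1,W=0] = 0` and `E_σ[R_i(X)|X_i=0,W=1] = 0`, then
`R_i` vanishes on all fully-participating report profiles (i.e. on `{0,1}^N`). -/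
theorem standard_mechanism_strictly_above_lower_bound
    (N : ℕ) (hN : 1 ≤ N) (p θ : ℝ) (hp0 : 0 < p) (hp1 : p < 1)
    (hθ : 1/2 < θ) (hθ1 : θ < 1)
    (g g' : ℝ → ℝ) (hg : ProperCost g g')
    (R : (Fin N → Report) → Fin N → ℝ) (hR : ∀ x i, 0 ≤ R x i)
    (σ : Fin N → Bool → Report → ℝ)
    (hNE : NashEq p θ g σ R)
    (i : Fin N) (ε : ℝ) (hε : 0 < ε)
    (hσi : σ i = epsStrategy ε) :
    VLB θ g' ε < expPay p θ σ R i ∧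
    (condPay p θ σ R i true false = 0 → condPay p θ σ R i false true = 0 →
      ∀ x : Fin N → Report, (∀ j, x j ≠ none) → R x i = 0) := by
  have hθ0 : 0 < θ := by linarith
  have hσ := hNE.1
  have hupd : Function.update σ i (epsStrategy ε) = σ := by rw [← hσi, Function.update_eq_self]
  have hU (δ : ℝ) (hδ : 0 < δ) : utility p θ g (Function.update σ i (epsStrategy δ)) R i =
      ((expPay p θ (Function.update σ i (epsStrategy δ)) R i - g δ : ℝ) : EReal) := by
    rw [utility, Function.update_self, privCost_epsStrategy g hδ, EReal.coe_sub]
  have hmax : IsLocalMax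
      (fun δ => expPay p θ (Function.update σ i (epsStrategy δ)) R i - g δ) ε := by
    filter_upwards [lt_mem_nhds hε] with δ hδ
    have h := hNE.2 i (epsStrategy δ) (epsStrategy_isStrategy δ)
    rw [hU δ hδ, ← hupd, Function.update_idem, hU ε hε, EReal.coe_le_coe_iff] at h
    exact h
  simp only [expPay_update_epsStrategy] at hmax
  have hfoc := deriv_eq_of_isLocalMax (hg.deriv ε hε.le) hmax
  have hval := expPay_update_epsStrategy (p := p) (θ := θ) (σ := σ) (R := R) i ε
  rw [hupd] at hval
  have hB := payWeight_nonneg hp0 hp1 hθ0 hθ1 hσ hR i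
  have hg' := hg.deriv_pos hε
  have hE := exp_pos ε
  -- the payments that are informative in the wrong direction cannot vanish
  have hZ : 0 < payWeight p θ σ R i true (some false) + payWeight p θ σ R i false (some true) := by
    by_contra! hle
    have h10 : payWeight p θ σ R i true (some false) = 0 := by
      linarith [hB true (some false), hB false (some true)]
    have h01 : payWeight p θ σ R i false (some true) = 0 := by
      linarith [hB true (some false), hB false (some true)]
    have h00 := payWeight_eq_zero_of_eq_zero hp0 hp1 hθ0 hθ1 hσ hR h10 false
    have h11 := payWeight_eq_zero_of_eq_zero hp0 hp1 hθ0 hθ1 hσ hR h01 true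
    rw [h00, h01, h10, h11] at hfoc
    have : 0 < g' ε * (exp ε + 1) ^ 2 := by positivity
    linarith
  refine ⟨?_, fun h1 h2 => ?_⟩
  · set Y := payWeight p θ σ R i true (some true) + payWeight p θ σ R i false (some false)
    set Z := payWeight p θ σ R i true (some false) + payWeight p θ σ R i false (some true)
    have hθ' : 2 * θ - 1 ≠ 0 := by linarith
    have hg'eq : g' ε = (2 * θ - 1) * (Y - Z) * exp ε / (exp ε + 1) ^ 2 := by
      rw [hfoc]
      field_simp
    have hgap : expPay p θ σ R i = VLB θ g' ε + Z := by
      rw [hval, VLB, hg'eq]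
      field_simp
      ring
    linarith
  · have hpos (b s : Bool) : σ i s (some b) ≠ 0 := by
      rw [hσi]
      simp only [epsStrategy]
      split_ifs <;> positivity
    have h01 := payWeight_eq_zero_of_condPay_eq_zero hp0 hp1 hθ0 hθ1 hσ (hpos true) h1
    have h10 := payWeight_eq_zero_of_condPay_eq_zero hp0 hp1 hθ0 hθ1 hσ (hpos false) h2
    exact absurd hZ (by rw [h01, h10]; simp)
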